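/- arXiv:2209.10281 — 2 statements merged into one kernel-verified Lean document; each statement's English description precedes it below -/
import Mathlib

section
/- If $v$ is a $C^2$ function on a domain $\Omega \subset \mathbb{R}^2$ satisfying $\nabla^2 v = \mu^2 v$ with $\mu \neq 0$, then for every closed disc $\overline{D_r(x)} \subset \Omega$ the weighted mean value identity $a(\mu r)\, v(x) = \frac{1}{\pi r^2}\int_{D_r(x)} v(y)\, \log\frac{r}{|x-y|}\, dy$ holds, where $a(t) = \frac{2(I_0(t)-1)}{t^2}$. -/
open MeasureTheory Real intervalIntegral

/-- Modified Bessel function of the first kind, order 0. -/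
noncomputable def besselI0 (t : ℝ) : ℝ :=
  (1 / π) * ∫ θ in (0:ℝ)..π, Real.cosh (t * Real.cos θ)

/-- Modified Bessel function of the first kind, order 1. -/
noncomputable def besselI1 (t : ℝ) : ℝ :=
  (1 / π) * ∫ θ in (0:ℝ)..π, Real.cosh (t * Real.cos θ) * Real.cos θ

/-- Bessel function of the first kind, order 0. -/
noncomputable def besselJ0 (t : ℝ) : ℝ :=
  (1 / π) * ∫ θ in (0:ℝ)..π, Real.cos (t * Real.sin θ)

/-- The Euclidean plane. -/
abbrev E2 := EuclideanSpace ℝ (Fin 2)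

/-- The Laplacian of a function on the plane, as a sum of second partial derivatives. -/
noncomputable def lap (f : E2 → ℝ) (y : E2) : ℝ :=
  ∑ i : Fin 2,
    fderiv ℝ (fun z => fderiv ℝ f z (EuclideanSpace.single i 1)) y (EuclideanSpace.single i 1)

/-- The point on the circle of radius `r` about `x` at angle `θ`. -/
noncomputable def circlePt (x : E2) (r θ : ℝ) : E2 :=
  x + (r * Real.cos θ) • EuclideanSpace.single 0 1 + (r * Real.sin θ) • EuclideanSpace.single 1 1

/-- radial unit vector -/
noncomputable def radE (θ : ℝ) : E2 :=
  Real.cos θ • EuclideanSpace.single 0 1 + Real.sin θ • EuclideanSpace.single 1 1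

/-- angular unit vector -/
noncomputable def angE (θ : ℝ) : E2 :=
  (-Real.sin θ) • EuclideanSpace.single 0 1 + Real.cos θ • EuclideanSpace.single 1 1

lemma hasDerivAt_radE (θ : ℝ) : HasDerivAt radE (angE θ) θ :=
  ((Real.hasDerivAt_cos θ).smul_const _).add ((Real.hasDerivAt_sin θ).smul_const _)

lemma hasDerivAt_angE (θ : ℝ) : HasDerivAt angE (-radE θ) θ := by
  have := (((Real.hasDerivAt_sin θ).neg).smul_const (EuclideanSpace.single 0 1 : E2)).add
    ((Real.hasDerivAt_cos θ).smul_const (EuclideanSpace.single 1 1 : E2))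
  refine this.congr_deriv ?_
  simp [radE]
  abel

@[fun_prop] lemma continuous_radE : Continuous radE := by unfold radE; fun_prop
@[fun_prop] lemma continuous_angE : Continuous angE := by unfold angE; fun_prop

lemma norm_radE (θ : ℝ) : ‖radE θ‖ = 1 := by
  simp [radE, EuclideanSpace.norm_eq, Fin.sum_univ_two]

/-- Differentiation under the integral sign, global continuous version. -/
lemma hasDerivAt_param (F F' : ℝ → ℝ → ℝ) (a b : ℝ)
    (hF : Continuous (Function.uncurry F)) (hF' : Continuous (Function.uncurry F'))
    (h : ∀ s t, HasDerivAt (fun s => F s t) (F' s t) s) (s : ℝ) :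
    HasDerivAt (fun s => ∫ t in a..b, F s t) (∫ t in a..b, F' s t) s := by
  obtain ⟨C, hC⟩ := ((isCompact_closedBall s (1:ℝ)).prod (isCompact_uIcc (a := a) (b := b))).exists_bound_of_continuousOn
    hF'.continuousOn
  refine (intervalIntegral.hasDerivAt_integral_of_dominated_loc_of_deriv_le
    (s := Metric.closedBall s 1) (bound := fun _ => C) (Metric.closedBall_mem_nhds s one_pos)
    ?_ ?_ ?_ ?_ ?_ ?_).2
  · exact Filter.Eventually.of_forall fun x =>
      (hF.comp (Continuous.prodMk_right x)).aestronglyMeasurable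
  · exact (hF.comp (Continuous.prodMk_right s)).intervalIntegrable _ _
  · exact (hF'.comp (Continuous.prodMk_right s)).aestronglyMeasurable
  · exact Filter.Eventually.of_forall fun t ht x hx =>
      hC (x, t) ⟨hx, Set.uIoc_subset_uIcc ht⟩
  · simp
  · exact Filter.Eventually.of_forall fun t ht x hx => h x t

/-- circle integral -/
noncomputable def MM (V : E2 → ℝ) (x : E2) (ρ : ℝ) : ℝ := ∫ θ in (-π)..π, V (x + ρ • radE θ)
noncomputable def BB (V : E2 → ℝ) (x : E2) (ρ : ℝ) : ℝ :=
  ∫ θ in (-π)..π, fderiv ℝ V (x + ρ • radE θ) (radE θ)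
noncomputable def CC (V : E2 → ℝ) (x : E2) (ρ : ℝ) : ℝ :=
  ∫ θ in (-π)..π, fderiv ℝ (fderiv ℝ V) (x + ρ • radE θ) (radE θ) (radE θ)

lemma cd1 {V : E2 → ℝ} (hV : ContDiff ℝ 2 V) : ContDiff ℝ 1 (fderiv ℝ V) := hV.fderiv_right (by norm_num)

lemma cont1 {V : E2 → ℝ} (hV : ContDiff ℝ 2 V) : Continuous (fderiv ℝ V) := (cd1 hV).continuous

lemma cont2 {V : E2 → ℝ} (hV : ContDiff ℝ 2 V) : Continuous (fderiv ℝ (fderiv ℝ V)) := (cd1 hV).continuous_fderiv (by norm_num)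

lemma hd1 {V : E2 → ℝ} (hV : ContDiff ℝ 2 V) (y : E2) : HasFDerivAt V (fderiv ℝ V y) y :=
  (hV.differentiable (by norm_num) y).hasFDerivAt

lemma hd2 {V : E2 → ℝ} (hV : ContDiff ℝ 2 V) (y : E2) : HasFDerivAt (fderiv ℝ V) (fderiv ℝ (fderiv ℝ V) y) y :=
  ((cd1 hV).differentiable (by norm_num) y).hasFDerivAt

lemma hasDerivAt_MM {V : E2 → ℝ} (hV : ContDiff ℝ 2 V) (x : E2) (ρ : ℝ) : HasDerivAt (MM V x) (BB V x ρ) ρ := by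
  have h0 := hV.continuous
  have h1 := cont1 hV
  refine hasDerivAt_param (fun ρ θ => V (x + ρ • radE θ))
    (fun ρ θ => fderiv ℝ V (x + ρ • radE θ) (radE θ)) (-π) π ?_ ?_ ?_ ρ
  · unfold Function.uncurry; fun_prop
  · unfold Function.uncurry
    exact (h1.comp (by fun_prop)).clm_apply (by fun_prop)
  · intro s t
    have : HasDerivAt (fun s : ℝ => x + s • radE t) (radE t) s := by
      simpa using ((hasDerivAt_id s).smul_const (radE t)).const_add x
    exact (hd1 hV _).comp_hasDerivAt s this

lemma hasDerivAt_BB {V : E2 → ℝ} (hV : ContDiff ℝ 2 V) (x : E2) (ρ : ℝ) : HasDerivAt (BB V x) (CC V x ρ) ρ := by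
  have h1 := cont1 hV
  have h2 := cont2 hV
  refine hasDerivAt_param (fun ρ θ => fderiv ℝ V (x + ρ • radE θ) (radE θ))
    (fun ρ θ => fderiv ℝ (fderiv ℝ V) (x + ρ • radE θ) (radE θ) (radE θ)) (-π) π ?_ ?_ ?_ ρ
  · unfold Function.uncurry
    exact (h1.comp (by fun_prop)).clm_apply (by fun_prop)
  · unfold Function.uncurry
    exact ((h2.comp (by fun_prop)).clm_apply (by fun_prop)).clm_apply (by fun_prop)
  · intro s t
    have : HasDerivAt (fun s : ℝ => x + s • radE t) (radE t) s := by
      simpa using ((hasDerivAt_id s).smul_const (radE t)).const_add x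
    have h3 := (hd2 hV (x + s • radE t)).comp_hasDerivAt s this
    simpa using h3.clm_apply (hasDerivAt_const s (radE t))

lemma lap_eq {V : E2 → ℝ} (hV : ContDiff ℝ 2 V) (y : E2) (θ : ℝ) : lap V y = fderiv ℝ (fderiv ℝ V) y (radE θ) (radE θ) +
    fderiv ℝ (fderiv ℝ V) y (angE θ) (angE θ) := by
  have key : ∀ e : E2, fderiv ℝ (fun z => fderiv ℝ V z e) y e
      = fderiv ℝ (fderiv ℝ V) y e e := by
    intro e
    have := ((hd2 hV y).clm_apply (hasFDerivAt_const e y)).fderiv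
    rw [this]; simp
  unfold lap
  simp only [key, Fin.sum_univ_two, radE, angE, map_add, map_smul, add_apply,
    smul_apply, smul_eq_mul]
  have := Real.sin_sq_add_cos_sq θ
  linear_combination (-(fderiv ℝ (fderiv ℝ V) y (EuclideanSpace.single 0 1) (EuclideanSpace.single 0 1))
    - (fderiv ℝ (fderiv ℝ V) y (EuclideanSpace.single 1 1) (EuclideanSpace.single 1 1))) * this

lemma radial_ode {V : E2 → ℝ} (hV : ContDiff ℝ 2 V) (x : E2) (μ r : ℝ) (hpan : ∀ y ∈ Metric.closedBall x r, lap V y = μ ^ 2 * V y)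
    (ρ : ℝ) (h0 : 0 < ρ) (hρ : ρ ≤ r) : ρ * CC V x ρ + BB V x ρ = μ ^ 2 * ρ * MM V x ρ := by
  have c0 := hV.continuous
  have c1 := cont1 hV
  have c2 := cont2 hV
  have cB : Continuous fun θ => fderiv ℝ V (x + ρ • radE θ) (radE θ) :=
    (c1.comp (by fun_prop)).clm_apply (by fun_prop)
  have cC : Continuous fun θ => fderiv ℝ (fderiv ℝ V) (x + ρ • radE θ) (radE θ) (radE θ) :=
    ((c2.comp (by fun_prop)).clm_apply (by fun_prop)).clm_apply (by fun_prop)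
  have cA : Continuous fun θ => fderiv ℝ (fderiv ℝ V) (x + ρ • radE θ) (angE θ) (angE θ) :=
    ((c2.comp (by fun_prop)).clm_apply (by fun_prop)).clm_apply (by fun_prop)
  have cM : Continuous fun θ => V (x + ρ • radE θ) := by fun_prop
  -- angular derivative
  have hd : ∀ θ, HasDerivAt (fun θ => fderiv ℝ V (x + ρ • radE θ) (angE θ))
      (ρ * fderiv ℝ (fderiv ℝ V) (x + ρ • radE θ) (angE θ) (angE θ)
        - fderiv ℝ V (x + ρ • radE θ) (radE θ)) θ := by
    intro θ
    have h3 : HasDerivAt (fun s : ℝ => x + ρ • radE s) (ρ • angE θ) θ :=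
      ((hasDerivAt_radE θ).const_smul ρ).const_add x
    have h35 : HasDerivAt (fun s : ℝ => fderiv ℝ V (x + ρ • radE s))
        (fderiv ℝ (fderiv ℝ V) (x + ρ • radE θ) (ρ • angE θ)) θ :=
      HasFDerivAt.comp_hasDerivAt (f := fun s : ℝ => x + ρ • radE s) θ (hd2 hV _) h3
    have h4 := h35.clm_apply (hasDerivAt_angE θ)
    refine h4.congr_deriv ?_
    rw [map_smul, map_neg, smul_apply, smul_eq_mul, sub_eq_add_neg]
  have hint : ∫ θ in (-π)..π, (ρ * fderiv ℝ (fderiv ℝ V) (x + ρ • radE θ) (angE θ) (angE θ)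
        - fderiv ℝ V (x + ρ • radE θ) (radE θ)) = 0 := by
    rw [intervalIntegral.integral_eq_sub_of_hasDerivAt (fun θ _ => hd θ)
      (((continuous_const.mul cA).sub cB).intervalIntegrable _ _)]
    simp [radE, angE]
  have e : ∀ θ, μ ^ 2 * ρ * V (x + ρ • radE θ) =
      ρ * fderiv ℝ (fderiv ℝ V) (x + ρ • radE θ) (radE θ) (radE θ)
      + (fderiv ℝ V (x + ρ • radE θ) (radE θ)
      + (ρ * fderiv ℝ (fderiv ℝ V) (x + ρ • radE θ) (angE θ) (angE θ)
        - fderiv ℝ V (x + ρ • radE θ) (radE θ))) := by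
    intro θ
    have hm : x + ρ • radE θ ∈ Metric.closedBall x r := by
      simp [norm_smul, norm_radE, abs_of_pos h0, hρ]
    have h5 := hpan _ hm
    rw [lap_eq hV _ θ] at h5
    linear_combination (-ρ) * h5
  unfold MM
  rw [← intervalIntegral.integral_const_mul]
  simp_rw [e]
  rw [intervalIntegral.integral_add, intervalIntegral.integral_add, hint,
    intervalIntegral.integral_const_mul]
  · simp [CC, BB]
  · exact cB.intervalIntegrable _ _
  · exact ((continuous_const.mul cA).sub cB).intervalIntegrable _ _
  · exact (continuous_const.mul cC).intervalIntegrable _ _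
  · exact (cB.add ((continuous_const.mul cA).sub cB)).intervalIntegrable _ _

lemma BB_zero {V : E2 → ℝ} (x : E2) : BB V x 0 = 0 := by
  simp only [BB, zero_smul, add_zero, radE, map_add, map_smul, smul_eq_mul]
  rw [intervalIntegral.integral_add]
  · simp
  all_goals exact Continuous.intervalIntegrable (by fun_prop) _ _

lemma MM_zero {V : E2 → ℝ} (x : E2) : MM V x 0 = 2 * π * V x := by
  simp only [MM, zero_smul, add_zero, intervalIntegral.integral_const, smul_eq_mul]
  ring

lemma MM_eq_zero {V : E2 → ℝ} (hV : ContDiff ℝ 2 V) (x : E2) (μ r : ℝ) (hpan : ∀ y ∈ Metric.closedBall x r, lap V y = μ ^ 2 * V y)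
    (hx : V x = 0) : ∀ ρ ∈ Set.Icc 0 r, MM V x ρ = 0 := by
  have hM := hasDerivAt_MM hV x
  have hB := hasDerivAt_BB hV x
  have hE : ∀ ρ, HasDerivAt (fun ρ => BB V x ρ ^ 2 - μ ^ 2 * MM V x ρ ^ 2)
      (2 * BB V x ρ * CC V x ρ - μ ^ 2 * (2 * MM V x ρ * BB V x ρ)) ρ := by
    intro ρ
    refine (((hB ρ).pow 2).sub (((hM ρ).pow 2).const_mul (μ^2))).congr_deriv ?_
    simp
  have anti : AntitoneOn (fun ρ => BB V x ρ ^ 2 - μ ^ 2 * MM V x ρ ^ 2) (Set.Icc 0 r) := by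
    apply antitoneOn_of_deriv_nonpos (convex_Icc 0 r)
    · exact fun ρ _ => (hE ρ).continuousAt.continuousWithinAt
    · exact fun ρ _ => (hE ρ).differentiableAt.differentiableWithinAt
    · intro ρ hρ
      rw [interior_Icc] at hρ
      rw [(hE ρ).deriv]
      have h6 := radial_ode hV x μ r hpan ρ hρ.1 hρ.2.le
      have h7 : CC V x ρ = μ ^ 2 * MM V x ρ - BB V x ρ / ρ := by
        have := hρ.1.ne'
        field_simp
        linear_combination h6
      have h8 : 0 ≤ BB V x ρ ^ 2 / ρ := div_nonneg (sq_nonneg _) hρ.1.le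
      rw [h7]
      have : 2 * BB V x ρ * (μ ^ 2 * MM V x ρ - BB V x ρ / ρ) - μ ^ 2 * (2 * MM V x ρ * BB V x ρ)
        = -2 * (BB V x ρ ^ 2 / ρ) := by ring
      linarith
  apply eq_zero_of_abs_deriv_le_mul_abs_self_of_eq_zero_right (f' := BB V x) (K := |μ|)
  · exact fun ρ _ => (hM ρ).continuousAt.continuousWithinAt
  · exact fun ρ _ => (hM ρ).hasDerivWithinAt
  · rw [MM_zero, hx, mul_zero]
  · intro ρ hρ
    have h9 := anti (Set.left_mem_Icc.2 (hρ.1.trans hρ.2.le)) ⟨hρ.1, hρ.2.le⟩ hρ.1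
    simp only [BB_zero, MM_zero, hx] at h9
    rw [Real.norm_eq_abs, Real.norm_eq_abs, ← abs_mul]
    apply sq_le_sq.1
    nlinarith

lemma log_integral {V : E2 → ℝ} (hV : ContDiff ℝ 2 V) (x : E2) (μ r : ℝ) (hr : 0 < r)
    (hpan : ∀ y ∈ Metric.closedBall x r, lap V y = μ ^ 2 * V y) :
    ∫ ρ in (0:ℝ)..r, μ ^ 2 * (ρ * Real.log (r / ρ) * MM V x ρ) = MM V x r - MM V x 0 := by
  have hM := hasDerivAt_MM hV x
  have hB := hasDerivAt_BB hV x
  have cM : Continuous (MM V x) := continuous_iff_continuousAt.2 fun ρ => (hM ρ).continuousAt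
  have cB : Continuous (BB V x) := continuous_iff_continuousAt.2 fun ρ => (hB ρ).continuousAt
  have hl : ∀ ρ : ℝ, ρ * Real.log (r / ρ) = ρ * Real.log r - ρ * Real.log ρ := by
    intro ρ
    by_cases h : ρ = 0
    · simp [h]
    · rw [Real.log_div hr.ne' h]; ring
  have hml := Real.continuous_mul_log
  simp_rw [hl]
  rw [integral_eq_sub_of_hasDerivAt_of_le
    (f := fun ρ => MM V x ρ + (ρ * Real.log r - ρ * Real.log ρ) * BB V x ρ) hr.le]
  · simp
  · exact (by fun_prop : Continuous _).continuousOn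
  · intro ρ hρ
    have h1 := (hM ρ).add ((((hasDerivAt_id ρ).mul_const (Real.log r)).sub
      (Real.hasDerivAt_mul_log hρ.1.ne')).mul (hB ρ))
    refine h1.congr_deriv ?_
    have h6 := radial_ode hV x μ r hpan ρ hρ.1 hρ.2.le
    simp only [id, Pi.sub_apply]
    linear_combination (Real.log r - Real.log ρ) * h6
  · exact (by fun_prop : Continuous _).intervalIntegrable _ _

lemma cosh_props (μ : ℝ) (x : E2) : ContDiff ℝ 2 (fun y : E2 => Real.cosh (μ * (y 0 - x 0))) ∧
    ∀ y, lap (fun y : E2 => Real.cosh (μ * (y 0 - x 0))) y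
      = μ ^ 2 * Real.cosh (μ * (y 0 - x 0)) := by
  constructor
  · have : ContDiff ℝ 2 (fun y : E2 => y 0) := by fun_prop
    exact Real.contDiff_cosh.comp (contDiff_const.mul (this.sub contDiff_const))
  · intro y
    let P : E2 →L[ℝ] ℝ := EuclideanSpace.proj (0 : Fin 2)
    have hl : ∀ y : E2, HasFDerivAt (fun y : E2 => μ * (y 0 - x 0)) (μ • P) y := fun y =>
      ((P.hasFDerivAt (x := y)).sub_const (x 0)).const_mul μ
    have h1 : ∀ y : E2, fderiv ℝ (fun y : E2 => Real.cosh (μ * (y 0 - x 0))) y =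
        Real.sinh (μ * (y 0 - x 0)) • μ • P := fun y => (hl y).cosh.fderiv
    have h2 : ∀ (c : ℝ) (y : E2), fderiv ℝ (fun y : E2 => Real.sinh (μ * (y 0 - x 0)) * c) y =
        c • Real.cosh (μ * (y 0 - x 0)) • μ • P := fun c y => ((hl y).sinh.mul_const c).fderiv
    unfold lap
    simp only [h1, Fin.sum_univ_two, smul_apply, smul_eq_mul, h2]
    simp [P]
    ring

lemma MM_cosh (μ : ℝ) (x : E2) (ρ : ℝ) :
    MM (fun y : E2 => Real.cosh (μ * (y 0 - x 0))) x ρ = 2 * π * besselI0 (μ * ρ) := by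
  have h : ∀ θ, Real.cosh (μ * ((x + ρ • radE θ) 0 - x 0)) = Real.cosh (μ * ρ * Real.cos θ) := by
    intro θ
    simp [radE, mul_assoc]
  have c : Continuous fun θ => Real.cosh (μ * ρ * Real.cos θ) := by fun_prop
  unfold MM besselI0
  simp_rw [h]
  rw [← intervalIntegral.integral_add_adjacent_intervals (b := 0) (c.intervalIntegrable _ _)
    (c.intervalIntegrable _ _)]
  have := intervalIntegral.integral_comp_neg (a := 0) (b := π)
    (fun θ => Real.cosh (μ * ρ * Real.cos θ))
  simp only [Real.cos_neg, neg_zero] at this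
  rw [← this]
  field_simp
  ring

lemma lap_congr {f g : E2 → ℝ} {y : E2} (h : f =ᶠ[nhds y] g) : lap f y = lap g y := by
  unfold lap
  refine Finset.sum_congr rfl fun i _ => ?_
  have : (fun z => fderiv ℝ f z (EuclideanSpace.single i 1)) =ᶠ[nhds y]
      (fun z => fderiv ℝ g z (EuclideanSpace.single i 1)) := by
    filter_upwards [h.fderiv (𝕜 := ℝ)] with z hz
    rw [hz]
  rw [this.fderiv_eq]

lemma lap_sub_mul {f g : E2 → ℝ} (hf : ContDiff ℝ 2 f) (hg : ContDiff ℝ 2 g) (c : ℝ) (y : E2) :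
    lap (fun z => f z - c * g z) y = lap f y - c * lap g y := by
  have h1 : fderiv ℝ (fun z => f z - c * g z) = fun z => fderiv ℝ f z - c • fderiv ℝ g z := by
    funext z
    exact ((hd1 hf z).sub ((hd1 hg z).const_mul c)).fderiv
  have h2 : fderiv ℝ (fun z => fderiv ℝ f z - c • fderiv ℝ g z) y =
      fderiv ℝ (fderiv ℝ f) y - c • fderiv ℝ (fderiv ℝ g) y :=
    ((hd2 hf y).sub ((hd2 hg y).const_smul c)).fderiv
  have hh : ContDiff ℝ 2 (fun z => f z - c * g z) := hf.sub (contDiff_const.mul hg)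
  rw [lap_eq hh y 0, lap_eq hf y 0, lap_eq hg y 0, h1, h2]
  simp
  ring

lemma MM_eq_bessel {V : E2 → ℝ} (hV : ContDiff ℝ 2 V) (x : E2) (μ r : ℝ) (hr : 0 ≤ r)
    (hpan : ∀ y ∈ Metric.closedBall x r, lap V y = μ ^ 2 * V y) :
    MM V x r = 2 * π * besselI0 (μ * r) * V x := by
  obtain ⟨h1, h2⟩ := cosh_props μ x
  set w : E2 → ℝ := fun y : E2 => Real.cosh (μ * (y 0 - x 0)) with hw
  have h3 := MM_eq_zero (V := fun z => V z - V x * w z) (hV.sub (contDiff_const.mul h1)) x μ r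
    (by
      intro y hy
      rw [lap_sub_mul hV h1, hpan y hy, h2]
      simp only [hw]; ring) (by simp [hw]) r ⟨hr, le_rfl⟩
  have c0 := hV.continuous
  have c1 := h1.continuous
  have h4 : MM (fun z => V z - V x * w z) x r = MM V x r - V x * MM w x r := by
    unfold MM
    rw [intervalIntegral.integral_sub, intervalIntegral.integral_const_mul]
    all_goals exact (by fun_prop : Continuous _).intervalIntegrable _ _
  rw [h4, MM_cosh] at h3
  linarith

lemma polar_E2 (f : E2 → ℝ) (x : E2) :
    ∫ y, f y = ∫ p in Set.Ioi (0:ℝ) ×ˢ Set.Ioo (-π) π, p.1 * f (x + p.1 • radE p.2) := by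
  rw [← MeasureTheory.integral_add_left_eq_self f x]
  rw [← (Complex.orthonormalBasisOneI.repr.measurePreserving).integral_comp
    Complex.orthonormalBasisOneI.repr.toHomeomorph.measurableEmbedding]
  rw [← Complex.integral_comp_polarCoord_symm, polarCoord_target]
  congr 1
  funext p
  have : Complex.orthonormalBasisOneI.repr (Complex.polarCoord.symm p) = p.1 • radE p.2 := by
    ext i
    fin_cases i <;> simp [radE, Complex.orthonormalBasisOneI, Complex.cos_ofReal_re, Complex.cos_ofReal_im, Complex.sin_ofReal_re, Complex.sin_ofReal_im]
  rw [this]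
  simp

lemma ball_integral {V : E2 → ℝ} (hV : Continuous V) (x : E2) (r : ℝ) (hr : 0 < r) :
    ∫ y in Metric.ball x r, V y * Real.log (r / ‖x - y‖) =
      ∫ ρ in (0:ℝ)..r, ρ * Real.log (r / ρ) * MM V x ρ := by
  rw [← MeasureTheory.integral_indicator Metric.isOpen_ball.measurableSet, polar_E2 _ x]
  set g : ℝ × ℝ → ℝ := fun p => p.1 * Real.log (r / p.1) * V (x + p.1 • radE p.2) with hg
  have cg : Continuous g := by
    have hl : ∀ ρ : ℝ, ρ * Real.log (r / ρ) = ρ * Real.log r - ρ * Real.log ρ := by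
      intro ρ
      by_cases h : ρ = 0
      · simp [h]
      · rw [Real.log_div hr.ne' h]; ring
    have hml := Real.continuous_mul_log
    simp only [hg, hl]
    have : Continuous fun p : ℝ × ℝ => p.1 * Real.log p.1 := hml.comp continuous_fst
    fun_prop
  have e1 : ∫ p in Set.Ioi (0:ℝ) ×ˢ Set.Ioo (-π) π, p.1 *
      (Metric.ball x r).indicator (fun y => V y * Real.log (r / ‖x - y‖)) (x + p.1 • radE p.2)
      = ∫ p in Set.Ioi (0:ℝ) ×ˢ Set.Ioo (-π) π, (Set.Iio r ×ˢ Set.univ).indicator g p := by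
    refine setIntegral_congr_fun (measurableSet_Ioi.prod measurableSet_Ioo) ?_
    rintro ⟨ρ, θ⟩ ⟨h1, h2⟩
    have h1' : 0 < ρ := h1
    by_cases h : ρ < r
    · simp [Set.indicator, h, norm_smul, norm_radE, abs_of_pos h1', hg]; ring
    · simp [Set.indicator, h, norm_smul, norm_radE, abs_of_pos h1']
  rw [e1, setIntegral_indicator (measurableSet_Iio.prod MeasurableSet.univ), Set.prod_inter_prod,
    Set.inter_univ, Set.Ioi_inter_Iio, Measure.volume_eq_prod, setIntegral_prod]
  · rw [intervalIntegral.integral_of_le hr.le, integral_Ioc_eq_integral_Ioo]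
    congr 1
    funext ρ
    rw [MM, intervalIntegral.integral_of_le (by linarith [Real.pi_pos]),
      integral_Ioc_eq_integral_Ioo, ← MeasureTheory.integral_const_mul]
  · refine IntegrableOn.mono_set (t := Set.Icc 0 r ×ˢ Set.Icc (-π) π) ?_
      (Set.prod_mono Set.Ioo_subset_Icc_self Set.Ioo_subset_Icc_self)
    exact cg.continuousOn.integrableOn_compact (isCompact_Icc.prod isCompact_Icc)

lemma exists_ext (Ω : Set E2) (hΩo : IsOpen Ω) (v : E2 → ℝ) (hv : ContDiffOn ℝ 2 v Ω)
    (x : E2) (r : ℝ) (hr : 0 < r) (hball : Metric.closedBall x r ⊆ Ω) :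
    ∃ V : E2 → ℝ, ContDiff ℝ 2 V ∧ ∀ y ∈ Metric.closedBall x r, V =ᶠ[nhds y] v := by
  obtain ⟨δ, hδ, hsub⟩ := (isCompact_closedBall x r).exists_cthickening_subset_open hΩo hball
  rw [cthickening_closedBall hδ.le hr.le] at hsub
  let b : ContDiffBump x := ⟨r + δ / 3, r + δ / 2, by linarith, by linarith⟩
  refine ⟨fun y => b y * v y, ?_, ?_⟩
  · rw [contDiff_iff_contDiffAt]
    intro y
    by_cases hy : y ∈ Ω
    · exact b.contDiffAt.mul (hv.contDiffAt (hΩo.mem_nhds hy))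
    · have h1 : y ∉ tsupport b := by
        rw [b.tsupport_eq]
        intro h
        exact hy (hsub (Metric.closedBall_subset_closedBall (by simp only [b]; linarith) h))
      have h2 : (fun y => b y * v y) =ᶠ[nhds y] fun _ => 0 := by
        filter_upwards [notMem_tsupport_iff_eventuallyEq.1 h1] with z hz
        simp [hz]
      exact contDiffAt_const.congr_of_eventuallyEq h2
  · intro y hy
    have : y ∈ Metric.ball x b.rIn :=
      Metric.closedBall_subset_ball (by simp only [b]; linarith) hy
    filter_upwards [b.eventuallyEq_one_of_mem_ball this] with z hz
    simp [hz]

theorem weighted_disc_mean_value_panharmonic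
    (Ω : Set E2) (hΩo : IsOpen Ω) (hΩc : IsConnected Ω)
    (v : E2 → ℝ) (hv : ContDiffOn ℝ 2 v Ω)
    (μ : ℝ) (hμ : μ ≠ 0)
    (hpan : ∀ y ∈ Ω, lap v y = μ ^ 2 * v y)
    (x : E2) (r : ℝ) (hr : 0 < r) (hball : Metric.closedBall x r ⊆ Ω) :
    (2 * (besselI0 (μ * r) - 1) / (μ * r) ^ 2) * v x =
      (1 / (π * r ^ 2)) * ∫ y in Metric.ball x r, v y * Real.log (r / ‖x - y‖) := by
  obtain ⟨V, hV, hVv⟩ := exists_ext Ω hΩo v hv x r hr hball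
  have hp : ∀ y ∈ Metric.closedBall x r, lap V y = μ ^ 2 * V y := by
    intro y hy
    rw [lap_congr (hVv y hy), (hVv y hy).eq_of_nhds, hpan y (hball hy)]
  have e : ∫ y in Metric.ball x r, v y * Real.log (r / ‖x - y‖) =
      ∫ y in Metric.ball x r, V y * Real.log (r / ‖x - y‖) := by
    refine setIntegral_congr_fun Metric.isOpen_ball.measurableSet fun y hy => ?_
    simp only [(hVv y (Metric.ball_subset_closedBall hy)).eq_of_nhds]
  have h1 := log_integral hV x μ r hr hp
  rw [intervalIntegral.integral_const_mul, ← ball_integral hV.continuous x r hr,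
    MM_eq_bessel hV x μ r hr.le hp, MM_zero] at h1
  rw [e, ← (hVv x (Metric.mem_closedBall_self hr.le)).eq_of_nhds]
  have hpi := Real.pi_ne_zero
  have hr' := hr.ne'
  field_simp
  linear_combination -h1
end

section
/- If $u$ is a $C^2$ function on a domain $\Omega \subset \mathbb{R}^2$ satisfying the Helmholtz equation $\nabla^2 u = -\lambda^2 u$ with $\lambda \neq 0$, then for every closed disc $\overline{D_r(x)} \subset \Omega$ the weighted mean value identity $\tilde{a}(\lambda r)\, u(x) = \frac{1}{\pi r^2}\int_{D_r(x)} u(y)\, \log\frac{r}{|x-y|}\, dy$ holds, where $\tilde{a}(t) = \frac{2(1 - J_0(t))}{t^2}$. -/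
open MeasureTheory Real intervalIntegral

namespace WDMV

open Set Filter Topology

lemma hasDerivAt_param {F F' : ℝ → ℝ → ℝ} (hF : Continuous (fun p : ℝ × ℝ => F p.1 p.2))
    (hF' : Continuous (fun p : ℝ × ℝ => F' p.1 p.2))
    (hd : ∀ s t, HasDerivAt (fun s => F s t) (F' s t) s) (a b s₀ : ℝ) :
    HasDerivAt (fun s => ∫ t in a..b, F s t) (∫ t in a..b, F' s₀ t) s₀ := by
  have hc : IsCompact (Icc (s₀ - 1) (s₀ + 1) ×ˢ uIcc a b) := isCompact_Icc.prod isCompact_uIcc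
  obtain ⟨C, hC⟩ := hc.exists_bound_of_continuousOn hF'.continuousOn
  have h1 : ∀ s, Continuous (F s) := fun s => by
    exact hF.comp (by fun_prop : Continuous (fun t : ℝ => (s, t)))
  have h2 : ∀ s, Continuous (F' s) := fun s => by
    exact hF'.comp (by fun_prop : Continuous (fun t : ℝ => (s, t)))
  refine (intervalIntegral.hasDerivAt_integral_of_dominated_loc_of_deriv_le (bound := fun _ => C)
    (Icc_mem_nhds (by linarith) (by linarith) : Icc (s₀ - 1) (s₀ + 1) ∈ 𝓝 s₀)
    (Eventually.of_forall fun s => (h1 s).aestronglyMeasurable)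
    ((h1 s₀).intervalIntegrable _ _) (h2 s₀).aestronglyMeasurable ?_ (by simp) ?_).2
  · exact Eventually.of_forall fun t ht s hs => hC (s, t) ⟨hs, uIoc_subset_uIcc ht⟩
  · exact Eventually.of_forall fun t ht s hs => hd s t

lemma continuous_circlePt (x : E2) : Continuous (fun p : ℝ × ℝ => circlePt x p.1 p.2) := by
  unfold circlePt
  fun_prop

lemma hasDerivAt_circlePt_r (x : E2) (s t : ℝ) : HasDerivAt (fun s => circlePt x s t)
    (Real.cos t • EuclideanSpace.single 0 1 + Real.sin t • EuclideanSpace.single 1 1) s := by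
  unfold circlePt
  have h1 := ((hasDerivAt_id s).mul_const (Real.cos t)).smul_const
    (EuclideanSpace.single 0 1 : E2)
  have h2 := ((hasDerivAt_id s).mul_const (Real.sin t)).smul_const
    (EuclideanSpace.single 1 1 : E2)
  refine ((h1.const_add x).add h2).congr_deriv ?_
  simp

lemma hasDerivAt_circlePt_t (x : E2) (s t : ℝ) : HasDerivAt (fun t => circlePt x s t)
    ((-(s * Real.sin t)) • EuclideanSpace.single 0 1
      + (s * Real.cos t) • EuclideanSpace.single 1 1) t := by
  unfold circlePt
  have h1 := ((Real.hasDerivAt_cos t).const_mul s).smul_const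
    (EuclideanSpace.single 0 1 : E2)
  have h2 := ((Real.hasDerivAt_sin t).const_mul s).smul_const
    (EuclideanSpace.single 1 1 : E2)
  refine ((h1.const_add x).add h2).congr_deriv ?_
  simp

/-- Integral over the circle. -/
noncomputable def M (u : E2 → ℝ) (x : E2) (s : ℝ) : ℝ := ∫ t in (-π)..π, u (circlePt x s t)

/-- Partial derivative. -/
noncomputable def pd (i : Fin 2) (u : E2 → ℝ) (z : E2) : ℝ :=
  fderiv ℝ u z (EuclideanSpace.single i 1)

lemma pd_contDiff {n m : WithTop ℕ∞} {u : E2 → ℝ} (hu : ContDiff ℝ n u) (h : m + 1 ≤ n) (i : Fin 2) :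
    ContDiff ℝ m (pd i u) :=
  (hu.fderiv_right h).clm_apply contDiff_const

lemma deriv_r {u : E2 → ℝ} (hu : ContDiff ℝ 1 u) (x : E2) (s t : ℝ) :
    HasDerivAt (fun s => u (circlePt x s t))
      (Real.cos t * pd 0 u (circlePt x s t) + Real.sin t * pd 1 u (circlePt x s t)) s := by
  have := (hu.differentiable (by norm_num) (circlePt x s t)).hasFDerivAt.comp_hasDerivAt s
    (hasDerivAt_circlePt_r x s t)
  simpa [pd, Function.comp_def] using this

lemma deriv_t {u : E2 → ℝ} (hu : ContDiff ℝ 1 u) (x : E2) (s t : ℝ) :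
    HasDerivAt (fun t => u (circlePt x s t))
      (-(s * Real.sin t) * pd 0 u (circlePt x s t)
        + s * Real.cos t * pd 1 u (circlePt x s t)) t := by
  have := (hu.differentiable (by norm_num) (circlePt x s t)).hasFDerivAt.comp_hasDerivAt t
    (hasDerivAt_circlePt_t x s t)
  simpa [pd, Function.comp_def] using this

/-- Radial derivative. -/
noncomputable def R1 (u : E2 → ℝ) (x : E2) (s t : ℝ) : ℝ :=
  Real.cos t * pd 0 u (circlePt x s t) + Real.sin t * pd 1 u (circlePt x s t)

/-- Second radial derivative. -/
noncomputable def R2 (u : E2 → ℝ) (x : E2) (s t : ℝ) : ℝ :=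
  Real.cos t * R1 (pd 0 u) x s t + Real.sin t * R1 (pd 1 u) x s t

/-- First derivative of the circle integral. -/
noncomputable def M1 (u : E2 → ℝ) (x : E2) (s : ℝ) : ℝ := ∫ t in (-π)..π, R1 u x s t

/-- Second derivative of the circle integral. -/
noncomputable def M2 (u : E2 → ℝ) (x : E2) (s : ℝ) : ℝ := ∫ t in (-π)..π, R2 u x s t

lemma cont_comp {v : E2 → ℝ} (hv : Continuous v) (x : E2) :
    Continuous (fun p : ℝ × ℝ => v (circlePt x p.1 p.2)) :=
  hv.comp (continuous_circlePt x)

lemma cont_R1 {u : E2 → ℝ} (hu : ContDiff ℝ 1 u) (x : E2) :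
    Continuous (fun p : ℝ × ℝ => R1 u x p.1 p.2) := by
  have h0 := cont_comp (pd_contDiff (m := 0) hu (by norm_num) 0).continuous x
  have h1 := cont_comp (pd_contDiff (m := 0) hu (by norm_num) 1).continuous x
  unfold R1
  fun_prop

lemma cont_R2 {u : E2 → ℝ} (hu : ContDiff ℝ 2 u) (x : E2) :
    Continuous (fun p : ℝ × ℝ => R2 u x p.1 p.2) := by
  have h0 := cont_R1 (pd_contDiff (m := 1) hu (by norm_num) 0) x
  have h1 := cont_R1 (pd_contDiff (m := 1) hu (by norm_num) 1) x
  unfold R2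
  fun_prop

lemma hasDerivAt_M {u : E2 → ℝ} (hu : ContDiff ℝ 2 u) (x : E2) (s : ℝ) :
    HasDerivAt (M u x) (M1 u x s) s :=
  hasDerivAt_param (cont_comp hu.continuous x) (cont_R1 (hu.of_le (by norm_num)) x)
    (fun s t => deriv_r (hu.of_le (by norm_num)) x s t) _ _ _

lemma hasDerivAt_M1 {u : E2 → ℝ} (hu : ContDiff ℝ 2 u) (x : E2) (s : ℝ) :
    HasDerivAt (M1 u x) (M2 u x s) s :=
  hasDerivAt_param (cont_R1 (hu.of_le (by norm_num)) x) (cont_R2 hu x)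
    (fun s t => ((deriv_r (pd_contDiff (m := 1) hu (by norm_num) 0) x s t).const_mul _).add
      ((deriv_r (pd_contDiff (m := 1) hu (by norm_num) 1) x s t).const_mul _)) _ _ _

lemma lap_eq (u : E2 → ℝ) (z : E2) : lap u z = pd 0 (pd 0 u) z + pd 1 (pd 1 u) z := by
  simp only [lap, Fin.sum_univ_two]; rfl

lemma polar_lap {u : E2 → ℝ} (hu : ContDiff ℝ 2 u) (x : E2) (s : ℝ) :
    s * M2 u x s + M1 u x s = s * M (lap u) x s := by
  have hl : Continuous (lap u) := by
    have h0 := (pd_contDiff (m := 0) (pd_contDiff (m := 1) hu (by norm_num) 0) (by norm_num) 0).continuous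
    have h1 := (pd_contDiff (m := 0) (pd_contDiff (m := 1) hu (by norm_num) 1) (by norm_num) 1).continuous
    simp_rw [funext (lap_eq u)]
    fun_prop
  have sec {F : ℝ → ℝ → ℝ} (hF : Continuous (fun p : ℝ × ℝ => F p.1 p.2)) : Continuous (F s) := by
    exact hF.comp (by fun_prop : Continuous (fun t : ℝ => (s, t)))
  have hR1 := sec (cont_R1 (hu.of_le (by norm_num)) x)
  have hR2 := sec (cont_R2 hu x)
  have hL : Continuous (fun t => lap u (circlePt x s t)) := sec (F := fun s t => lap u (circlePt x s t)) (cont_comp hl x)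
  set T' : ℝ → ℝ := fun t => s * lap u (circlePt x s t) - s * R2 u x s t - R1 u x s t with hT'
  have hT'c : Continuous T' := by fun_prop
  have hd : ∀ t, HasDerivAt (fun t => -Real.sin t * pd 0 u (circlePt x s t)
      + Real.cos t * pd 1 u (circlePt x s t)) (T' t) t := by
    intro t
    have h0 := (Real.hasDerivAt_sin t).neg.mul
      (deriv_t (pd_contDiff (m := 1) hu (by norm_num) 0) x s t)
    have h1 := (Real.hasDerivAt_cos t).mul
      (deriv_t (pd_contDiff (m := 1) hu (by norm_num) 1) x s t)
    refine (h0.add h1).congr_deriv ?_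
    simp only [hT', lap_eq, R1, R2, Pi.neg_apply]
    linear_combination (s * (pd 0 (pd 0 u) (circlePt x s t) + pd 1 (pd 1 u) (circlePt x s t))) * (Real.sin_sq_add_cos_sq t)
  have hI : ∫ t in (-π)..π, T' t = 0 := by
    rw [integral_eq_sub_of_hasDerivAt (fun t _ => hd t) (hT'c.intervalIntegrable _ _)]
    simp [circlePt]
  simp only [hT'] at hI
  rw [intervalIntegral.integral_sub, intervalIntegral.integral_sub,
    intervalIntegral.integral_const_mul, intervalIntegral.integral_const_mul] at hI
  · unfold M M1 M2; linarith
  all_goals exact Continuous.intervalIntegrable (by fun_prop) _ _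

lemma norm_circlePt (x : E2) (s t : ℝ) : ‖x - circlePt x s t‖ = |s| := by
  rw [EuclideanSpace.norm_eq, Fin.sum_univ_two, ← Real.sqrt_sq_eq_abs]
  congr 1
  simp only [circlePt, Real.norm_eq_abs, sq_abs]
  simp
  linear_combination s ^ 2 * Real.sin_sq_add_cos_sq t

lemma ode {u : E2 → ℝ} (hu : ContDiff ℝ 2 u) {lam : ℝ} {x : E2} {r : ℝ}
    (hH : ∀ y ∈ Metric.closedBall x r, lap u y = -(lam ^ 2) * u y) {s : ℝ} (hs : s ∈ Icc 0 r) :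
    s * M2 u x s + M1 u x s = -(lam ^ 2) * (s * M u x s) := by
  rw [polar_lap hu]
  have : M (lap u) x s = -(lam ^ 2) * M u x s := by
    unfold M
    rw [← intervalIntegral.integral_const_mul]
    congr 1
    ext t
    apply hH
    rw [Metric.mem_closedBall, dist_comm, dist_eq_norm, norm_circlePt, abs_of_nonneg hs.1]
    exact hs.2
  rw [this]; ring

lemma M_zero (u : E2 → ℝ) (x : E2) : M u x 0 = 2 * π * u x := by
  simp [M, circlePt, -mul_eq_mul_right_iff]; ring

lemma M1_zero {u : E2 → ℝ} (hu : ContDiff ℝ 2 u) (x : E2) : M1 u x 0 = 0 := by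
  simpa using polar_lap hu x 0

lemma unique {u : E2 → ℝ} (hu : ContDiff ℝ 2 u) {lam : ℝ} (hlam : lam ≠ 0) {x : E2} {r : ℝ}
    (hr : 0 < r)
    (hH : ∀ y ∈ Metric.closedBall x r, lap u y = -(lam ^ 2) * u y) (hx : u x = 0) :
    M u x r = 0 := by
  have hd : ∀ s, HasDerivAt (fun s => M1 u x s ^ 2 + lam ^ 2 * M u x s ^ 2)
      (2 * M1 u x s * M2 u x s + lam ^ 2 * (2 * M u x s * M1 u x s)) s := fun s => by
    have := ((hasDerivAt_M1 hu x s).pow 2).add (((hasDerivAt_M hu x s).pow 2).const_mul (lam ^ 2))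
    refine this.congr_deriv ?_
    simp
  have hanti := antitoneOn_of_deriv_nonpos (convex_Icc 0 r)
    (f := fun s => M1 u x s ^ 2 + lam ^ 2 * M u x s ^ 2)
    (fun s _ => (hd s).continuousAt.continuousWithinAt)
    (fun s _ => (hd s).differentiableAt.differentiableWithinAt) (by
      intro s hs
      rw [interior_Icc] at hs
      rw [(hd s).deriv]
      have := ode hu hH (Ioo_subset_Icc_self hs)
      have h2 : s * (2 * M1 u x s * M2 u x s + lam ^ 2 * (2 * M u x s * M1 u x s))
        = -2 * M1 u x s ^ 2 := by linear_combination (2 * M1 u x s) * this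
      by_contra! hcon
      nlinarith [mul_pos hs.1 hcon, sq_nonneg (M1 u x s)])
  have := hanti (left_mem_Icc.2 hr.le) (right_mem_Icc.2 hr.le) hr.le
  simp only [M1_zero hu, M_zero, hx] at this
  have h1 : 0 < lam ^ 2 := by positivity
  have h3 : lam ^ 2 * M u x r ^ 2 = 0 := by
    nlinarith [sq_nonneg (M1 u x r), mul_nonneg h1.le (sq_nonneg (M u x r))]
  simpa [hlam] using h3

lemma exists_ext {Ω : Set E2} (hΩo : IsOpen Ω) {u : E2 → ℝ} (hu : ContDiffOn ℝ 2 u Ω)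
    {x : E2} {r : ℝ} (hr : 0 < r) (hball : Metric.closedBall x r ⊆ Ω) :
    ∃ v : E2 → ℝ, ContDiff ℝ 2 v ∧ ∀ y ∈ Metric.closedBall x r, v =ᶠ[𝓝 y] u := by
  obtain ⟨δ, hδ, hsub⟩ := (isCompact_closedBall x r).exists_cthickening_subset_open hΩo hball
  rw [cthickening_closedBall hδ.le hr.le] at hsub
  let f : ContDiffBump x := ⟨r + δ / 2, r + δ, by linarith, by linarith⟩
  refine ⟨fun y => f y * u y, ?_, ?_⟩
  · rw [contDiff_iff_contDiffAt]
    intro y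
    by_cases hy : y ∈ Ω
    · exact f.contDiffAt.mul ((hu y hy).contDiffAt (hΩo.mem_nhds hy))
    · have hy' : y ∉ tsupport f := by
        rw [f.tsupport_eq]
        exact fun h => hy (hsub (by rw [add_comm]; exact h))
      have : (fun y => f y * u y) =ᶠ[𝓝 y] fun _ => 0 := by
        filter_upwards [notMem_tsupport_iff_eventuallyEq.1 hy'] with z hz
        simp [hz]
      exact contDiffAt_const.congr_of_eventuallyEq this
  · intro y hy
    have : Metric.ball x (r + δ / 2) ∈ 𝓝 y := Metric.isOpen_ball.mem_nhds (by
      rw [Metric.mem_closedBall] at hy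
      rw [Metric.mem_ball]; linarith)
    filter_upwards [this] with z hz
    rw [f.one_of_mem_closedBall (Metric.ball_subset_closedBall hz), one_mul]

lemma lap_congr {u v : E2 → ℝ} {y : E2} (h : v =ᶠ[𝓝 y] u) : lap v y = lap u y := by
  unfold lap
  refine Finset.sum_congr rfl fun i _ => ?_
  have : (fun z => fderiv ℝ v z (EuclideanSpace.single i 1)) =ᶠ[𝓝 y]
      (fun z => fderiv ℝ u z (EuclideanSpace.single i 1)) := by
    filter_upwards [h.fderiv (𝕜 := ℝ)] with z hz
    rw [hz]
  rw [this.fderiv_eq]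

lemma pd_sub {u v : E2 → ℝ} (hu : Differentiable ℝ u) (hv : Differentiable ℝ v) (c : ℝ)
    (i : Fin 2) : pd i (fun y => u y - c * v y) = fun y => pd i u y - c * pd i v y := by
  ext y
  unfold pd
  rw [fderiv_fun_sub (hu y) ((hv y).const_mul c), fderiv_const_mul (hv y)]
  simp

lemma lap_sub {u v : E2 → ℝ} (hu : ContDiff ℝ 2 u) (hv : ContDiff ℝ 2 v) (c : ℝ) (y : E2) :
    lap (fun y => u y - c * v y) y = lap u y - c * lap v y := by
  have d {f : E2 → ℝ} (hf : ContDiff ℝ 2 f) (i : Fin 2) : Differentiable ℝ (pd i f) :=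
    (pd_contDiff (m := 1) hf (by norm_num) i).differentiable (by norm_num)
  have hu' := hu.differentiable (by norm_num)
  have hv' := hv.differentiable (by norm_num)
  simp only [lap_eq, pd_sub hu' hv', pd_sub (d hu _) (d hv _)]
  ring

lemma pd_coord {g g' : ℝ → ℝ} (hg : ∀ s, HasDerivAt g (g' s) s) (i : Fin 2) :
    pd i (fun y => g (y 1)) = fun y => g' (y 1) * (EuclideanSpace.single i (1:ℝ) : E2) 1 := by
  ext y
  have h1 : HasFDerivAt (fun y : E2 => y 1) (EuclideanSpace.proj 1 : E2 →L[ℝ] ℝ) y :=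
    (EuclideanSpace.proj 1 : E2 →L[ℝ] ℝ).hasFDerivAt
  have h2 := (hg (y 1)).comp_hasFDerivAt y h1
  unfold pd
  erw [h2.fderiv]
  simp

/-- The reference solution. -/
noncomputable def ref (lam : ℝ) (x : E2) (y : E2) : ℝ := Real.cos (lam * (y 1 - x 1))

lemma ref_contDiff (lam : ℝ) (x : E2) : ContDiff ℝ 2 (ref lam x) := by
  unfold ref
  have : ContDiff ℝ 2 (fun y : E2 => y 1) :=
    (EuclideanSpace.proj 1 : E2 →L[ℝ] ℝ).contDiff
  exact Real.contDiff_cos.comp (contDiff_const.mul (this.sub contDiff_const))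

lemma lap_ref (lam : ℝ) (x y : E2) : lap (ref lam x) y = -(lam ^ 2) * ref lam x y := by
  have h1 : ∀ s : ℝ, HasDerivAt (fun s => Real.cos (lam * (s - x 1)))
      (-Real.sin (lam * (s - x 1)) * lam) s := fun s => by
    have := (((hasDerivAt_id s).sub_const (x 1)).const_mul lam).cos
    simpa using this
  have h2 : ∀ s : ℝ, HasDerivAt (fun s => -Real.sin (lam * (s - x 1)) * lam)
      (-(Real.cos (lam * (s - x 1)) * lam) * lam) s := fun s => by
    have := ((((hasDerivAt_id s).sub_const (x 1)).const_mul lam).sin.neg).mul_const lam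
    refine this.congr_deriv ?_
    simp
  have h0 : pd 0 (ref lam x) = fun y => (0 : ℝ) := by
    unfold ref; rw [pd_coord h1]; ext y; simp
  have h0' : pd 1 (ref lam x) = fun y => -Real.sin (lam * (y 1 - x 1)) * lam := by
    unfold ref; rw [pd_coord h1]; ext y; simp
  rw [lap_eq, h0, h0', pd_coord h2]
  simp [pd, ref]
  ring

lemma M_ref (lam : ℝ) (x : E2) (s : ℝ) : M (ref lam x) x s = 2 * π * besselJ0 (lam * s) := by
  have h1 : M (ref lam x) x s = ∫ t in (-π)..π, Real.cos (lam * s * Real.sin t) := by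
    unfold M ref
    congr 1; ext t
    simp [circlePt, mul_assoc]
  have hc : Continuous (fun t => Real.cos (lam * s * Real.sin t)) := by fun_prop
  have h2 : ∫ t in (-π)..0, Real.cos (lam * s * Real.sin t)
      = ∫ t in (0:ℝ)..π, Real.cos (lam * s * Real.sin t) := by
    have := intervalIntegral.integral_comp_neg (a := 0) (b := π) (fun t => Real.cos (lam * s * Real.sin t))
    rw [neg_zero] at this
    rw [← this]
    congr 1; ext t; simp
  rw [h1, ← intervalIntegral.integral_add_adjacent_intervals (hc.intervalIntegrable (-π) 0)
    (hc.intervalIntegrable 0 π), h2, besselJ0]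
  field_simp
  ring

lemma M_eq {u : E2 → ℝ} (hu : ContDiff ℝ 2 u) {lam : ℝ} (hlam : lam ≠ 0) {x : E2} {r : ℝ}
    (hr : 0 < r)
    (hH : ∀ y ∈ Metric.closedBall x r, lap u y = -(lam ^ 2) * u y) :
    M u x r = 2 * π * besselJ0 (lam * r) * u x := by
  have hv := ref_contDiff lam x
  have h := unique (u := fun y => u y - u x * ref lam x y) (hu.sub (contDiff_const.mul hv)) hlam hr
    (fun y hy => by rw [lap_sub hu hv, hH y hy, lap_ref]; ring) (by simp [ref])
  have sec {f : E2 → ℝ} (hf : ContDiff ℝ 2 f) : Continuous (fun t => f (circlePt x r t)) := by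
    exact (cont_comp hf.continuous x).comp (by fun_prop : Continuous (fun t : ℝ => (r, t)))
  have h2 : M (fun y => u y - u x * ref lam x y) x r = M u x r - u x * M (ref lam x) x r := by
    unfold M
    rw [intervalIntegral.integral_sub, intervalIntegral.integral_const_mul]
    · exact (sec hu).intervalIntegrable _ _
    · exact ((sec hv).const_mul _).intervalIntegrable _ _
  rw [h2, M_ref] at h
  linarith

lemma polar_ball (g : E2 → ℝ) (x : E2) {r : ℝ} :
    ∫ y in Metric.ball x r, g y
      = ∫ p in Ioo (0:ℝ) r ×ˢ Ioo (-π) π, p.1 * g (circlePt x p.1 p.2) := by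
  set h := (Metric.ball x r).indicator g with hh
  rw [← MeasureTheory.integral_indicator Metric.isOpen_ball.measurableSet, ← hh,
    ← MeasureTheory.integral_add_left_eq_self h x]
  have mp := (volume_preserving_finTwoArrow ℝ).comp (PiLp.volume_preserving_ofLp (Fin 2))
  have e1 : ∫ z : E2, h (x + z)
      = ∫ w : ℝ × ℝ, h (x + (w.1 • EuclideanSpace.single 0 1 + w.2 • EuclideanSpace.single 1 1)) := by
    rw [← mp.integral_comp ((MeasurableEquiv.toLp 2 (Fin 2 → ℝ)).symm.trans
      MeasurableEquiv.finTwoArrow).measurableEmbedding]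
    congr 1
    ext z
    congr 2
    ext i
    fin_cases i <;> simp [MeasurableEquiv.finTwoArrow]
  rw [e1, ← integral_comp_polarCoord_symm]
  have e2 : Ioo (0:ℝ) r ×ˢ Ioo (-π) π = polarCoord.target ∩ (Iio r ×ˢ univ) := by
    ext p; simp [polarCoord]; tauto
  rw [e2, ← MeasureTheory.setIntegral_indicator (measurableSet_Iio.prod MeasurableSet.univ)]
  refine MeasureTheory.setIntegral_congr_fun polarCoord.open_target.measurableSet ?_
  intro p hp
  have hp0 : 0 < p.1 := hp.1
  have e3 : x + ((polarCoord.symm p).1 • EuclideanSpace.single 0 1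
    + (polarCoord.symm p).2 • EuclideanSpace.single 1 1) = circlePt x p.1 p.2 := by
    simp [circlePt, polarCoord, add_assoc]
  simp only [smul_eq_mul]
  rw [e3, hh]
  have e4 : circlePt x p.1 p.2 ∈ Metric.ball x r ↔ p.1 < r := by
    rw [Metric.mem_ball, dist_comm, dist_eq_norm, norm_circlePt, abs_of_pos hp0]
  by_cases hpr : p.1 < r
  · rw [indicator_of_mem (e4.2 hpr), indicator_of_mem (by simpa using hpr)]
  · rw [indicator_of_notMem (fun h => hpr (e4.1 h)), indicator_of_notMem (by simpa using hpr)]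
    simp

lemma cont_xlog {r : ℝ} (hr : 0 < r) : Continuous (fun s : ℝ => s * Real.log (r / s)) := by
  have : (fun s : ℝ => s * Real.log (r / s)) = fun s => s * Real.log r - s * Real.log s := by
    ext s
    by_cases hs : s = 0
    · simp [hs]
    · rw [Real.log_div hr.ne' hs]; ring
  rw [this]
  exact (continuous_id.mul continuous_const).sub Real.continuous_mul_log

lemma radial {u : E2 → ℝ} (hu : ContDiff ℝ 2 u) {lam : ℝ} {x : E2} {r : ℝ}
    (hr : 0 < r)
    (hH : ∀ y ∈ Metric.closedBall x r, lap u y = -(lam ^ 2) * u y) :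
    -(lam ^ 2) * ∫ s in (0:ℝ)..r, s * Real.log (r / s) * M u x s = M u x r - M u x 0 := by
  have hl := cont_xlog hr
  have hM : Continuous (M u x) := continuous_iff_continuousAt.2 fun s => (hasDerivAt_M hu x s).continuousAt
  have hM1 : Continuous (M1 u x) := continuous_iff_continuousAt.2 fun s => (hasDerivAt_M1 hu x s).continuousAt
  rw [← intervalIntegral.integral_const_mul]
  rw [integral_eq_sub_of_hasDerivAt_of_le
    (f := fun s => s * Real.log (r / s) * M1 u x s + M u x s) hr.le
    (by fun_prop) ?_ (Continuous.intervalIntegrable (by fun_prop) _ _)]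
  · simp [hr.ne']
  · intro s hs
    have hs0 : s ≠ 0 := hs.1.ne'
    have hdl : HasDerivAt (fun s => s * Real.log (r / s)) (Real.log (r / s) - 1) s := by
      have h1 : HasDerivAt (fun s : ℝ => r / s) (-r / s ^ 2) s := by
        have := (hasDerivAt_inv hs0).const_mul r
        refine (this.congr_deriv (by ring)).congr_of_eventuallyEq ?_
        exact Eventually.of_forall fun s => by simp [div_eq_mul_inv]
      have := (hasDerivAt_id s).mul (h1.log (by positivity))
      refine this.congr_deriv ?_
      simp
      field_simp
      ring
    refine ((hdl.mul (hasDerivAt_M1 hu x s)).add (hasDerivAt_M hu x s)).congr_deriv ?_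
    have := ode hu hH (Ioo_subset_Icc_self hs)
    linear_combination Real.log (r / s) * this

lemma main_smooth {u : E2 → ℝ} (hu : ContDiff ℝ 2 u) {lam : ℝ} (hlam : lam ≠ 0) {x : E2} {r : ℝ}
    (hr : 0 < r)
    (hH : ∀ y ∈ Metric.closedBall x r, lap u y = -(lam ^ 2) * u y) :
    (2 * (1 - besselJ0 (lam * r)) / (lam * r) ^ 2) * u x =
      (1 / (π * r ^ 2)) * ∫ y in Metric.ball x r, u y * Real.log (r / ‖x - y‖) := by
  have key : ∫ y in Metric.ball x r, u y * Real.log (r / ‖x - y‖)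
      = ∫ s in (0:ℝ)..r, s * Real.log (r / s) * M u x s := by
    rw [polar_ball]
    have e : ∫ p in Ioo (0:ℝ) r ×ˢ Ioo (-π) π, p.1 * (u (circlePt x p.1 p.2) *
          Real.log (r / ‖x - circlePt x p.1 p.2‖))
        = ∫ p in Ioo (0:ℝ) r ×ˢ Ioo (-π) π, p.1 * Real.log (r / p.1) * u (circlePt x p.1 p.2) := by
      refine MeasureTheory.setIntegral_congr_fun (measurableSet_Ioo.prod measurableSet_Ioo) ?_
      intro p hp
      have hp0 : 0 < p.1 := hp.1.1
      simp only [norm_circlePt, abs_of_pos hp0]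
      ring
    have hc : Continuous (fun p : ℝ × ℝ => p.1 * Real.log (r / p.1) * u (circlePt x p.1 p.2)) :=
      ((cont_xlog hr).comp continuous_fst).mul (cont_comp hu.continuous x)
    rw [e, MeasureTheory.Measure.volume_eq_prod, MeasureTheory.setIntegral_prod]
    · rw [intervalIntegral.integral_of_le hr.le, MeasureTheory.integral_Ioc_eq_integral_Ioo]
      refine MeasureTheory.setIntegral_congr_fun measurableSet_Ioo ?_
      intro s hs
      simp only [M]
      rw [MeasureTheory.integral_const_mul, intervalIntegral.integral_of_le (by linarith [Real.pi_pos]),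
        MeasureTheory.integral_Ioc_eq_integral_Ioo]
    · exact (hc.continuousOn.integrableOn_compact
        ((isCompact_Icc (a := (0:ℝ)) (b := r)).prod (isCompact_Icc (a := -π) (b := π)))).mono_set
        (prod_mono Ioo_subset_Icc_self Ioo_subset_Icc_self)
  have h1 := radial hu hr hH
  rw [M_eq hu hlam hr hH, M_zero, ← key] at h1
  set I := ∫ y in Metric.ball x r, u y * Real.log (r / ‖x - y‖)
  have hpi := Real.pi_ne_zero
  have hr' := hr.ne'
  field_simp
  linear_combination h1

end WDMV

theorem weighted_disc_mean_value_helmholtz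
    (Ω : Set E2) (hΩo : IsOpen Ω) (hΩc : IsConnected Ω)
    (u : E2 → ℝ) (hu : ContDiffOn ℝ 2 u Ω)
    (lam : ℝ) (hlam : lam ≠ 0)
    (hHh : ∀ y ∈ Ω, lap u y = -(lam ^ 2) * u y)
    (x : E2) (r : ℝ) (hr : 0 < r) (hball : Metric.closedBall x r ⊆ Ω) :
    (2 * (1 - besselJ0 (lam * r)) / (lam * r) ^ 2) * u x =
      (1 / (π * r ^ 2)) * ∫ y in Metric.ball x r, u y * Real.log (r / ‖x - y‖) := by 
  obtain ⟨v, hv, hvu⟩ := WDMV.exists_ext hΩo hu hr hball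
  have hx : v x = u x := (hvu x (Metric.mem_closedBall_self hr.le)).self_of_nhds
  have h := WDMV.main_smooth hv hlam (x := x) hr (fun y hy => by
    rw [WDMV.lap_congr (hvu y hy), (hvu y hy).self_of_nhds, hHh y (hball hy)])
  rw [hx] at h
  rw [h]
  congr 1
  refine MeasureTheory.setIntegral_congr_fun Metric.isOpen_ball.measurableSet fun y hy => ?_
  simp only [(hvu y (Metric.ball_subset_closedBall hy)).self_of_nhds]
end
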